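/- arXiv:0910.4627 — 4 statements merged into one kernel-verified Lean document; each statement's English description precedes it below -/
import Mathlib

section
/- Let g : ℝ → ℝ be a convex three times differentiable function such that |g'''(t)| ≤ S·g''(t) for all t ∈ ℝ, for some S ≥ 0. Then for all t ≥ 0: (g''(0)/S²)·(e^{−St} + St − 1) ≤ g(t) − g(0) − g'(0)·t ≤ (g''(0)/S²)·(e^{St} − St − 1). -/
/-- The lower Taylor-expansion coefficient: for `a = S·t ≠ 0` it equals
`c / a² · (e^{-a} + a - 1)` (with `c = g''(0)·t²`), and for `a = 0` it is
interpreted by continuity as the quadratic `c / 2`. -/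
noncomputable def lowCoef (c a : ℝ) : ℝ :=
  if a = 0 then c / 2 else c / a ^ 2 * (Real.exp (-a) + a - 1)

/-- The upper Taylor-expansion coefficient: for `a ≠ 0` it equals
`c / a² · (e^{a} - a - 1)`, and for `a = 0` it is interpreted by continuity
as the quadratic `c / 2`. -/
noncomputable def upCoef (c a : ℝ) : ℝ :=
  if a = 0 then c / 2 else c / a ^ 2 * (Real.exp a - a - 1)

theorem monotoneOn_Ici_of_hasDerivAt_nonneg {f f' : ℝ → ℝ} (hf : ∀ x, HasDerivAt f (f' x) x)
    (hf' : ∀ x, 0 ≤ x → 0 ≤ f' x) : MonotoneOn f (Set.Ici 0) := by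
  refine monotoneOn_of_deriv_nonneg (convex_Ici 0)
    (fun x _ => (hf x).continuousAt.continuousWithinAt)
    (fun x _ => (hf x).differentiableAt.differentiableWithinAt) fun x hx => ?_
  rw [(hf x).deriv]
  exact hf' x (interior_subset hx)

theorem nonneg_of_hasDerivAt_hasDerivAt_nonneg {f f' f'' : ℝ → ℝ}
    (hf : ∀ x, HasDerivAt f (f' x) x) (hf' : ∀ x, HasDerivAt f' (f'' x) x)
    (h₀ : f 0 = 0) (h₀' : f' 0 = 0) (hf'' : ∀ x, 0 ≤ x → 0 ≤ f'' x) {t : ℝ} (ht : 0 ≤ t) :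
    0 ≤ f t := by
  have hnonneg : ∀ x, 0 ≤ x → 0 ≤ f' x := fun x hx => by
    simpa [h₀'] using monotoneOn_Ici_of_hasDerivAt_nonneg hf' hf'' Set.self_mem_Ici hx hx
  simpa [h₀] using monotoneOn_Ici_of_hasDerivAt_nonneg hf hnonneg Set.self_mem_Ici ht ht

theorem lowCoef_eq_upCoef_neg (c a : ℝ) : lowCoef c a = upCoef c (-a) := by
  simp [lowCoef, upCoef]

theorem upCoef_zero_left (a : ℝ) : upCoef 0 a = 0 := by
  simp [upCoef]

/-- The function `t ↦ upCoef (c * t ^ 2) (k * t)` has second derivative `t ↦ c * exp (k * t)`,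
and its first derivative vanishes at `0`. -/
theorem exists_hasDerivAt_upCoef (c k : ℝ) :
    ∃ u : ℝ → ℝ, (∀ x, HasDerivAt (fun t => upCoef (c * t ^ 2) (k * t)) (u x) x) ∧
      (∀ x, HasDerivAt u (c * Real.exp (k * x)) x) ∧ u 0 = 0 := by
  rcases eq_or_ne k 0 with rfl | hk
  · refine ⟨fun x => c * x, fun x => ?_, fun x => ?_, by simp⟩
    · have h := (((hasDerivAt_id x).pow 2).const_mul c).div_const 2
      simp only [upCoef, zero_mul, if_true]
      refine h.congr_deriv ?_
      simp
      ring
    · simpa using (hasDerivAt_id x).const_mul c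
  · have hlin : ∀ x, HasDerivAt (fun t => k * t) k x := fun x => by
      simpa using (hasDerivAt_id x).const_mul k
    have heq : (fun t => upCoef (c * t ^ 2) (k * t)) =
        fun t => c / k ^ 2 * (Real.exp (k * t) - k * t - 1) := by
      funext t
      rcases eq_or_ne t 0 with rfl | ht
      · simp [upCoef]
      · rw [upCoef, if_neg (mul_ne_zero hk ht)]
        field_simp
    refine ⟨fun x => c / k * (Real.exp (k * x) - 1), fun x => ?_, fun x => ?_, by simp⟩
    · rw [heq]
      refine ((((hlin x).exp.sub (hlin x)).sub_const 1).const_mul (c / k ^ 2)).congr_deriv ?_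
      field_simp
    · refine (((hlin x).exp.sub_const 1).const_mul (c / k)).congr_deriv ?_
      field_simp

/-- Exponential growth bounds from a differential inequality `|f'| ≤ S * f`. -/
theorem mul_exp_neg_le_and_le_mul_exp_of_abs_deriv_le {f f' : ℝ → ℝ} {S : ℝ}
    (hf : ∀ x, HasDerivAt f (f' x) x) (hS : ∀ x, |f' x| ≤ S * f x) {t : ℝ} (ht : 0 ≤ t) :
    f 0 * Real.exp (-S * t) ≤ f t ∧ f t ≤ f 0 * Real.exp (S * t) := by
  have hprod : ∀ k x, HasDerivAt (fun s => f s * Real.exp (k * s))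
      ((f' x + k * f x) * Real.exp (k * x)) x := fun k x => by
    have hlin : HasDerivAt (fun s => k * s) k x := by
      simpa using (hasDerivAt_id x).const_mul k
    exact ((hf x).mul hlin.exp).congr_deriv (by ring)
  constructor
  · have hmono := monotoneOn_Ici_of_hasDerivAt_nonneg (hprod S)
      (fun x _ => mul_nonneg (by linarith [(abs_le.mp (hS x)).1]) (Real.exp_pos _).le)
      Set.self_mem_Ici ht ht
    simp only [mul_zero, Real.exp_zero, mul_one] at hmono
    rw [neg_mul, Real.exp_neg, ← div_eq_mul_inv]
    exact (div_le_iff₀ (Real.exp_pos _)).mpr hmono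
  · have hmono := monotoneOn_Ici_of_hasDerivAt_nonneg (fun x => (hprod (-S) x).neg)
      (fun x _ => by
        rw [← neg_mul]
        exact mul_nonneg (by linarith [(abs_le.mp (hS x)).2]) (Real.exp_pos _).le)
      Set.self_mem_Ici ht ht
    simp only [Pi.neg_apply, mul_zero, Real.exp_zero, mul_one, neg_le_neg_iff] at hmono
    rw [neg_mul, Real.exp_neg, ← div_eq_mul_inv] at hmono
    exact (div_le_iff₀ (Real.exp_pos _)).mp hmono

/-- Let `g : ℝ → ℝ` be a convex three times differentiable function
such that `|g'''(t)| ≤ S·g''(t)` for all `t ∈ ℝ`, for some `S ≥ 0`. Then for all `t ≥ 0`: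
`(g''(0)/S²)·(e^{−St} + St − 1) ≤ g(t) − g(0) − g'(0)·t ≤ (g''(0)/S²)·(e^{St} − St − 1)`
(when `S = 0` the bounds are interpreted by continuity as the quadratic `(g''(0)/2)·t²`). -/
theorem lower_and_upper_taylor_univariate
    (g : ℝ → ℝ) (S : ℝ) (hS : 0 ≤ S)
    (hconv : ConvexOn ℝ Set.univ g) (hg : ContDiff ℝ 3 g)
    (hctrl : ∀ t : ℝ, |deriv (deriv (deriv g)) t| ≤ S * deriv (deriv g) t) :
    ∀ t : ℝ, 0 ≤ t →
      lowCoef (deriv (deriv g) 0 * t ^ 2) (S * t) ≤ g t - g 0 - deriv g 0 * t ∧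
      g t - g 0 - deriv g 0 * t ≤ upCoef (deriv (deriv g) 0 * t ^ 2) (S * t) := by
  have hg₁ : ContDiff ℝ 2 (deriv g) := ContDiff.deriv' (n := 2) hg
  have hg₂ : ContDiff ℝ 1 (deriv (deriv g)) := ContDiff.deriv' (n := 1) hg₁
  have hd₀ : ∀ x, HasDerivAt g (deriv g x) x := fun x =>
    (hg.differentiable (by norm_num) x).hasDerivAt
  have hd₁ : ∀ x, HasDerivAt (deriv g) (deriv (deriv g) x) x := fun x =>
    (hg₁.differentiable (by norm_num) x).hasDerivAt
  have hd₂ : ∀ x, HasDerivAt (deriv (deriv g)) (deriv (deriv (deriv g)) x) x := fun x =>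
    (hg₂.differentiable (by norm_num) x).hasDerivAt
  have hrem : ∀ x, HasDerivAt (fun s => g s - g 0 - deriv g 0 * s) (deriv g x - deriv g 0) x :=
    fun x => (((hd₀ x).sub_const (g 0)).sub
      ((hasDerivAt_id x).const_mul (deriv g 0))).congr_deriv (by simp)
  have hrem' : ∀ x, HasDerivAt (fun s => deriv g s - deriv g 0) (deriv (deriv g) x) x :=
    fun x => (hd₁ x).sub_const _
  have hbound := fun x (hx : 0 ≤ x) =>
    mul_exp_neg_le_and_le_mul_exp_of_abs_deriv_le hd₂ hctrl hx
  intro t ht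
  constructor
  · obtain ⟨u, hu, hu', hu₀⟩ := exists_hasDerivAt_upCoef (deriv (deriv g) 0) (-S)
    rw [lowCoef_eq_upCoef_neg, ← neg_mul]
    exact sub_nonneg.mp (nonneg_of_hasDerivAt_hasDerivAt_nonneg
      (fun x => (hrem x).sub (hu x)) (fun x => (hrem' x).sub (hu' x))
      (by simp [upCoef_zero_left]) (by simp [hu₀])
      (fun x hx => sub_nonneg.mpr (hbound x hx).1) ht)
  · obtain ⟨u, hu, hu', hu₀⟩ := exists_hasDerivAt_upCoef (deriv (deriv g) 0) S
    exact sub_nonneg.mp (nonneg_of_hasDerivAt_hasDerivAt_nonneg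
      (fun x => (hu x).sub (hrem x)) (fun x => (hu' x).sub (hrem' x))
      (by simp [upCoef_zero_left]) (by simp [hu₀])
      (fun x hx => sub_nonneg.mpr (hbound x hx).2) ht)
end

section
/- Let g : ℝ → ℝ be a convex three times differentiable function such that |g'''(t)| ≤ S·g''(t) for all t ∈ ℝ, for some S ≥ 0. If there exists t₀ ∈ ℝ with g''(t₀) > 0, then g''(t) > 0 for all t ∈ ℝ. -/
/-- A differentiable real function whose derivative is bounded in absolute value by a constant
multiple of the function is positive everywhere as soon as it is positive somewhere. -/
theorem pos_of_abs_deriv_le_mul {f : ℝ → ℝ} {S : ℝ} (hf : Differentiable ℝ f)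
    (hS : ∀ t, |deriv f t| ≤ S * f t) {t₀ : ℝ} (ht₀ : 0 < f t₀) (t : ℝ) : 0 < f t := by
  have hd (c x : ℝ) : HasDerivAt (fun y => f y * Real.exp (c * y))
      ((deriv f x + c * f x) * Real.exp (c * x)) x := by
    have he : HasDerivAt (fun y => Real.exp (c * y)) (Real.exp (c * x) * (c * 1)) x :=
      ((hasDerivAt_id x).const_mul c).exp
    exact ((hf x).hasDerivAt.mul he).congr_deriv (by ring)
  have hmono : Monotone fun y => f y * Real.exp (S * y) :=
    monotone_of_hasDerivAt_nonneg (hd S) fun x =>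
      mul_nonneg (by linarith [(abs_le.mp (hS x)).1]) (Real.exp_pos _).le
  have hanti : Antitone fun y => f y * Real.exp (-S * y) :=
    antitone_of_hasDerivAt_nonpos (hd (-S)) fun x =>
      mul_nonpos_of_nonpos_of_nonneg (by linarith [(abs_le.mp (hS x)).2]) (Real.exp_pos _).le
  rcases le_total t₀ t with h | h
  · exact pos_of_mul_pos_left ((mul_pos ht₀ (Real.exp_pos _)).trans_le (hmono h))
      (Real.exp_pos _).le
  · exact pos_of_mul_pos_left ((mul_pos ht₀ (Real.exp_pos _)).trans_le (hanti h))
      (Real.exp_pos _).le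

/-- Let `g : ℝ → ℝ` be a convex three times differentiable function
such that `|g'''(t)| ≤ S·g''(t)` for all `t ∈ ℝ`, for some `S ≥ 0`. If there exists
`t₀ ∈ ℝ` with `g''(t₀) > 0`, then `g''(t) > 0` for all `t ∈ ℝ`. -/
theorem second_deriv_pos_of_exists_pos
    (g : ℝ → ℝ) (S : ℝ) (hS : 0 ≤ S)
    (hconv : ConvexOn ℝ Set.univ g) (hg : ContDiff ℝ 3 g)
    (hctrl : ∀ t : ℝ, |deriv (deriv (deriv g)) t| ≤ S * deriv (deriv g) t)
    (t₀ : ℝ) (ht₀ : 0 < deriv (deriv g) t₀) :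
    ∀ t : ℝ, 0 < deriv (deriv g) t := by
  have hdiff : Differentiable ℝ (deriv (deriv g)) := by
    simpa [iteratedDeriv_succ, iteratedDeriv_zero] using
      hg.differentiable_iteratedDeriv 2 (by norm_num)
  exact pos_of_abs_deriv_le_mul hdiff hctrl ht₀
end

section
/- Let F : ℝ^p → ℝ be a convex three times differentiable function such that for all w, v ∈ ℝ^p the function g(t) = F(w + t·v) satisfies |g'''(t)| ≤ R·‖v‖₂·g''(t) for all t ∈ ℝ, for some R ≥ 0. Then for all w, v ∈ ℝ^p with v ≠ 0: F(w+v) ≥ F(w) + vᵀF'(w) + (vᵀF''(w)v / (R²‖v‖₂²))·(e^{−R‖v‖₂} + R‖v‖₂ − 1). -/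
/-- The `n`-th directional differential along a line has the next one as its derivative. -/
theorem hasDerivAt_iteratedFDeriv_line {E G : Type*} [NormedAddCommGroup E] [NormedSpace ℝ E]
    [NormedAddCommGroup G] [NormedSpace ℝ G] {f : E → G} {k : WithTop ℕ∞} (hf : ContDiff ℝ k f)
    {n : ℕ} (hn : (n : WithTop ℕ∞) < k) (w v : E) (t : ℝ) :
    HasDerivAt (fun s : ℝ => iteratedFDeriv ℝ n f (w + s • v) (fun _ => v))
      (iteratedFDeriv ℝ (n + 1) f (w + t • v) (fun _ => v)) t := by
  have hline : HasDerivAt (fun s : ℝ => w + s • v) v t := by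
    simpa using ((hasDerivAt_id t).smul_const v).const_add w
  have hd := ((hf.differentiable_iteratedFDeriv hn) (w + t • v)).hasFDerivAt.comp_hasDerivAt t hline
  have happ := (ContinuousMultilinearMap.apply ℝ (fun _ : Fin n => E) G
    (fun _ => v)).hasFDerivAt.comp_hasDerivAt t hd
  rw [iteratedFDeriv_succ_apply_left]
  exact happ

/-- A function on the half-line with nonnegative derivative stays above its value at `0`. -/
theorem le_of_hasDerivAt_nonneg {h h' : ℝ → ℝ} (hd : ∀ t, HasDerivAt h (h' t) t)
    (hnn : ∀ t, 0 ≤ t → 0 ≤ h' t) {t : ℝ} (ht : 0 ≤ t) : h 0 ≤ h t := by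
  have hmono : MonotoneOn h (Set.Ici 0) := by
    refine monotoneOn_of_hasDerivWithinAt_nonneg (convex_Ici 0)
      (fun x _ => (hd x).continuousAt.continuousWithinAt)
      (fun x _ => (hd x).hasDerivWithinAt) (fun x hx => hnn x ?_)
    exact interior_subset hx
  exact hmono Set.self_mem_Ici ht ht

/-- If `g' ≥ -a g` on the half-line, then `g(t) ≥ g(0) e^{-a t}` there. -/
theorem mul_exp_neg_le_of_neg_mul_le_deriv {g g' : ℝ → ℝ} {a : ℝ}
    (hd : ∀ t, HasDerivAt g (g' t) t) (hle : ∀ t, 0 ≤ t → -(a * g t) ≤ g' t) {t : ℝ}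
    (ht : 0 ≤ t) : g 0 * Real.exp (-(a * t)) ≤ g t := by
  have hexp (s : ℝ) : HasDerivAt (fun s => Real.exp (a * s)) (Real.exp (a * s) * a) s := by
    simpa using ((hasDerivAt_id s).const_mul a).exp
  have key := le_of_hasDerivAt_nonneg (fun s => (hd s).mul (hexp s)) (fun s hs => by
    nlinarith [mul_nonneg (sub_nonneg.2 (hle s hs)) (Real.exp_pos (a * s)).le]) ht
  simp only [Pi.mul_apply, mul_zero, Real.exp_zero, mul_one] at key
  rw [Real.exp_neg, ← div_eq_mul_inv, div_le_iff₀ (Real.exp_pos _)]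
  exact key

/-- Second-order comparison at `0`: if `u'' ≤ g''` on the half-line and `u` vanishes to first order
at `0`, then `g` lies above its first-order expansion plus `u`. -/
theorem add_add_le_of_second_deriv_le {g g₁ g₂ u u₁ u₂ : ℝ → ℝ}
    (hg : ∀ t, HasDerivAt g (g₁ t) t) (hg₁ : ∀ t, HasDerivAt g₁ (g₂ t) t)
    (hu : ∀ t, HasDerivAt u (u₁ t) t) (hu₁ : ∀ t, HasDerivAt u₁ (u₂ t) t)
    (hle : ∀ t, 0 ≤ t → u₂ t ≤ g₂ t) (hu0 : u 0 = 0) (hu₁0 : u₁ 0 = 0) {t : ℝ} (ht : 0 ≤ t) :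
    g 0 + g₁ 0 * t + u t ≤ g t := by
  have hfirst (s : ℝ) (hs : 0 ≤ s) : g₁ 0 - u₁ 0 ≤ g₁ s - u₁ s :=
    le_of_hasDerivAt_nonneg (h := fun s => g₁ s - u₁ s) (fun s => (hg₁ s).sub (hu₁ s))
      (fun s hs => sub_nonneg.2 (hle s hs)) hs
  have hlin (s : ℝ) : HasDerivAt (fun s => g₁ 0 * s) (g₁ 0) s := by
    simpa using (hasDerivAt_id s).const_mul (g₁ 0)
  have hzero := le_of_hasDerivAt_nonneg (h := fun s => g s - u s - g₁ 0 * s)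
    (fun s => ((hg s).sub (hu s)).sub (hlin s))
    (fun s hs => by linarith [hfirst s hs]) ht
  simp only [hu0, mul_zero] at hzero
  linarith

/-- The one-dimensional lower Taylor expansion. -/
theorem add_lowCoef_le {g g₁ g₂ g₃ : ℝ → ℝ} {a : ℝ}
    (hg : ∀ t, HasDerivAt g (g₁ t) t) (hg₁ : ∀ t, HasDerivAt g₁ (g₂ t) t)
    (hg₂ : ∀ t, HasDerivAt g₂ (g₃ t) t) (hle : ∀ t, 0 ≤ t → -(a * g₂ t) ≤ g₃ t) :
    g 0 + g₁ 0 + lowCoef (g₂ 0) a ≤ g 1 := by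
  have hlow (t : ℝ) (ht : 0 ≤ t) := mul_exp_neg_le_of_neg_mul_le_deriv hg₂ hle ht
  unfold lowCoef
  split_ifs with ha
  · have key := add_add_le_of_second_deriv_le hg hg₁
      (u := fun t => g₂ 0 / 2 * t ^ 2) (u₁ := fun t => g₂ 0 * t) (u₂ := fun _ => g₂ 0)
      (fun t => ((hasDerivAt_pow 2 t).const_mul (g₂ 0 / 2)).congr_deriv (by
        norm_num
        ring))
      (fun t => by simpa using (hasDerivAt_id t).const_mul (g₂ 0))
      (fun t ht => by simpa [ha] using hlow t ht) (by simp) (by simp) zero_le_one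
    simpa using key
  · have hexp (s : ℝ) : HasDerivAt (fun s => Real.exp (-(a * s))) (Real.exp (-(a * s)) * -a) s := by
      simpa using ((hasDerivAt_id s).const_mul a).neg.exp
    have hlin (s : ℝ) : HasDerivAt (fun s => a * s) a s := by
      simpa using (hasDerivAt_id s).const_mul a
    have key := add_add_le_of_second_deriv_le hg hg₁
      (u := fun t => g₂ 0 / a ^ 2 * (Real.exp (-(a * t)) + a * t - 1))
      (u₁ := fun t => g₂ 0 / a * (1 - Real.exp (-(a * t))))
      (u₂ := fun t => g₂ 0 * Real.exp (-(a * t)))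
      (fun t => ((((hexp t).add (hlin t)).sub_const 1).const_mul (g₂ 0 / a ^ 2)).congr_deriv (by
        field_simp
        ring))
      (fun t => (((hexp t).const_sub 1).const_mul (g₂ 0 / a)).congr_deriv (by
        field_simp))
      hlow (by simp) (by simp) zero_le_one
    simpa using key

/-- Let `F : ℝ^p → ℝ` be a convex three times differentiable function
such that for all `w, v ∈ ℝ^p` the function `g(t) = F(w + t·v)` satisfies
`|g'''(t)| ≤ R·‖v‖₂·g''(t)` for all `t ∈ ℝ`, for some `R ≥ 0` (equivalently, the third
directional differential satisfies `|F'''(w)[v,v,v]| ≤ R·‖v‖₂·F''(w)[v,v]` everywhere).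
Then for all `w, v ∈ ℝ^p` with `v ≠ 0`:
`F(w+v) ≥ F(w) + vᵀF'(w) + (vᵀF''(w)v / (R²‖v‖₂²))·(e^{−R‖v‖₂} + R‖v‖₂ − 1)`. -/
theorem lower_taylor_expansion_multivariate
    (p : ℕ) (F : EuclideanSpace ℝ (Fin p) → ℝ) (R : ℝ) (hR : 0 ≤ R)
    (hconv : ConvexOn ℝ Set.univ F) (hF : ContDiff ℝ 3 F)
    (hctrl : ∀ w v : EuclideanSpace ℝ (Fin p),
      |iteratedFDeriv ℝ 3 F w ![v, v, v]| ≤ R * ‖v‖ * iteratedFDeriv ℝ 2 F w ![v, v]) :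
    ∀ w v : EuclideanSpace ℝ (Fin p), v ≠ 0 →
      F w + fderiv ℝ F w v + lowCoef (iteratedFDeriv ℝ 2 F w ![v, v]) (R * ‖v‖) ≤
        F (w + v) := by
  intro w v _
  have hvec2 : (![v, v] : Fin 2 → _) = fun _ => v := by
    ext1 i; fin_cases i <;> rfl
  have hvec3 : (![v, v, v] : Fin 3 → _) = fun _ => v := by
    ext1 i; fin_cases i <;> rfl
  have key := add_lowCoef_le (a := R * ‖v‖)
    (hasDerivAt_iteratedFDeriv_line (n := 0) hF (by norm_num) w v)
    (hasDerivAt_iteratedFDeriv_line (n := 1) hF (by norm_num) w v)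
    (hasDerivAt_iteratedFDeriv_line (n := 2) hF (by norm_num) w v)
    (fun t _ => by
      have h := hctrl (w + t • v) v
      rw [hvec3, hvec2] at h
      exact neg_le_of_abs_le h)
  simpa [hvec2] using key
end

section
/- Let x₁, …, xₙ ∈ ℝ^p with R = max_{1 ≤ i ≤ n} ‖xᵢ‖₂, let y₁, …, yₙ ∈ {−1, 1}, and define Ĵ₀(w) = (1/n)·Σᵢ₌₁ⁿ [ℓ(wᵀxᵢ) − (yᵢ/2)·wᵀxᵢ] where ℓ(u) = log(e^{−u/2} + e^{u/2}). Then Ĵ₀ is convex, three times differentiable, and for all w, v ∈ ℝ^p the function g(t) = Ĵ₀(w + t·v) satisfies |g'''(t)| ≤ R·‖v‖₂·g''(t) for all t ∈ ℝ. -/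
/-- The (symmetrized) logistic loss `ℓ(u) = log(e^{−u/2} + e^{u/2})`. -/
noncomputable def ell (u : ℝ) : ℝ := Real.log (Real.exp (-u / 2) + Real.exp (u / 2))

/-- The Euclidean dot product `wᵀx` on `ℝ^p`. -/
noncomputable def dotE {p : ℕ} (w x : EuclideanSpace ℝ (Fin p)) : ℝ := ∑ j, w j * x j

/-- The empirical logistic risk
`Ĵ₀(w) = (1/n)·Σᵢ [ℓ(wᵀxᵢ) − (yᵢ/2)·wᵀxᵢ]`. -/
noncomputable def empRisk {n p : ℕ} (x : Fin n → EuclideanSpace ℝ (Fin p))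
    (y : Fin n → ℝ) (w : EuclideanSpace ℝ (Fin p)) : ℝ :=
  (1 / n : ℝ) * ∑ i, (ell (dotE w (x i)) - y i / 2 * dotE w (x i))

lemma exp_neg_half_add_exp_half_pos (u : ℝ) : 0 < Real.exp (-u / 2) + Real.exp (u / 2) := by
  positivity

lemma hasDerivAt_exp_neg_half (u : ℝ) :
    HasDerivAt (fun u : ℝ => Real.exp (-u / 2)) (-(Real.exp (-u / 2) / 2)) u := by
  refine ((hasDerivAt_neg u).div_const 2).exp.congr_deriv ?_
  ring

lemma hasDerivAt_exp_half (u : ℝ) :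
    HasDerivAt (fun u : ℝ => Real.exp (u / 2)) (Real.exp (u / 2) / 2) u := by
  refine ((hasDerivAt_id' u).div_const 2).exp.congr_deriv ?_
  ring

/-- The first derivative of the logistic loss. -/
noncomputable def ellDeriv (u : ℝ) : ℝ :=
  (Real.exp (u / 2) - Real.exp (-u / 2)) / (2 * (Real.exp (-u / 2) + Real.exp (u / 2)))

/-- The second derivative of the logistic loss. -/
noncomputable def ellDeriv2 (u : ℝ) : ℝ :=
  1 / (Real.exp (-u / 2) + Real.exp (u / 2)) ^ 2

/-- The third derivative of the logistic loss. -/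
noncomputable def ellDeriv3 (u : ℝ) : ℝ :=
  -(Real.exp (u / 2) - Real.exp (-u / 2)) / (Real.exp (-u / 2) + Real.exp (u / 2)) ^ 3

lemma hasDerivAt_ell (u : ℝ) : HasDerivAt ell (ellDeriv u) u := by
  have hs := exp_neg_half_add_exp_half_pos u
  refine (((hasDerivAt_exp_neg_half u).fun_add
    (hasDerivAt_exp_half u)).log hs.ne').congr_deriv ?_
  rw [ellDeriv]
  field_simp
  ring

lemma hasDerivAt_ellDeriv (u : ℝ) : HasDerivAt ellDeriv (ellDeriv2 u) u := by
  have hs := exp_neg_half_add_exp_half_pos u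
  have hp : Real.exp (-(u / 2)) * Real.exp (u / 2) = 1 := by
    rw [← Real.exp_add, neg_add_cancel, Real.exp_zero]
  refine (((hasDerivAt_exp_half u).fun_sub (hasDerivAt_exp_neg_half u)).fun_div
    (((hasDerivAt_exp_neg_half u).fun_add (hasDerivAt_exp_half u)).const_mul 2)
    (mul_pos two_pos hs).ne').congr_deriv ?_
  rw [ellDeriv2]
  simp only [neg_div] at hs ⊢
  field_simp
  linear_combination 4 * hp

lemma hasDerivAt_ellDeriv2 (u : ℝ) : HasDerivAt ellDeriv2 (ellDeriv3 u) u := by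
  have hs := exp_neg_half_add_exp_half_pos u
  refine ((hasDerivAt_const u (1 : ℝ)).fun_div
    (((hasDerivAt_exp_neg_half u).fun_add (hasDerivAt_exp_half u)).fun_pow 2)
    (pow_pos hs 2).ne').congr_deriv ?_
  rw [ellDeriv3]
  field_simp
  ring

lemma ellDeriv2_nonneg (u : ℝ) : 0 ≤ ellDeriv2 u := by
  unfold ellDeriv2
  positivity

lemma abs_ellDeriv3_le (u : ℝ) : |ellDeriv3 u| ≤ ellDeriv2 u := by
  have hs := exp_neg_half_add_exp_half_pos u
  rw [ellDeriv3, ellDeriv2, abs_div, abs_neg, abs_of_pos (pow_pos hs 3),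
    div_le_div_iff₀ (pow_pos hs 3) (pow_pos hs 2), one_mul, pow_succ _ 2, mul_comm]
  gcongr
  rw [abs_le]
  constructor <;> linarith [Real.exp_pos (u / 2), Real.exp_pos (-u / 2)]

lemma convexOn_ell : ConvexOn ℝ Set.univ ell := by
  have h1 : deriv ell = ellDeriv := funext fun u => (hasDerivAt_ell u).deriv
  have h2 : deriv ellDeriv = ellDeriv2 := funext fun u => (hasDerivAt_ellDeriv u).deriv
  refine convexOn_univ_of_deriv2_nonneg (fun u => (hasDerivAt_ell u).differentiableAt)
    (h1 ▸ fun u => (hasDerivAt_ellDeriv u).differentiableAt) fun u => ?_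
  rw [Function.iterate_succ, Function.iterate_one, Function.comp_apply, h1, h2]
  exact ellDeriv2_nonneg u

lemma contDiff_ell {k : WithTop ℕ∞} : ContDiff ℝ k ell := by
  unfold ell
  exact ContDiff.log (by fun_prop) fun u => (exp_neg_half_add_exp_half_pos u).ne'

lemma dotE_eq_inner {p : ℕ} (w x : EuclideanSpace ℝ (Fin p)) : dotE w x = inner ℝ x w := by
  simp [dotE, PiLp.inner_apply]

lemma dotE_add_smul {p : ℕ} (w v x : EuclideanSpace ℝ (Fin p)) (s : ℝ) :
    dotE (w + s • v) x = dotE w x + s * dotE v x := by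
  simp only [dotE_eq_inner, inner_add_right, inner_smul_right]

lemma abs_dotE_le {p : ℕ} (w x : EuclideanSpace ℝ (Fin p)) : |dotE w x| ≤ ‖x‖ * ‖w‖ :=
  dotE_eq_inner w x ▸ abs_real_inner_le_norm x w

lemma convexOn_empRisk {n p : ℕ} (x : Fin n → EuclideanSpace ℝ (Fin p)) (y : Fin n → ℝ) :
    ConvexOn ℝ Set.univ (empRisk x y) := by
  refine ⟨convex_univ, fun w _ v _ a b ha hb hab => ?_⟩
  simp only [empRisk, smul_eq_mul]
  rw [mul_left_comm a, mul_left_comm b, ← mul_add]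
  refine mul_le_mul_of_nonneg_left ?_ (by positivity)
  rw [Finset.mul_sum, Finset.mul_sum, ← Finset.sum_add_distrib]
  refine Finset.sum_le_sum fun i _ => ?_
  have hd : dotE (a • w + b • v) (x i) = a * dotE w (x i) + b * dotE v (x i) := by
    simp only [dotE_eq_inner, inner_add_right, inner_smul_right]
  have h := convexOn_ell.2 (Set.mem_univ (dotE w (x i))) (Set.mem_univ (dotE v (x i))) ha hb hab
  simp only [smul_eq_mul] at h
  rw [hd]
  linarith

lemma contDiff_empRisk {n p : ℕ} (x : Fin n → EuclideanSpace ℝ (Fin p)) (y : Fin n → ℝ)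
    {k : WithTop ℕ∞} : ContDiff ℝ k (empRisk x y) := by
  unfold empRisk
  simp only [dotE_eq_inner]
  refine contDiff_const.mul (ContDiff.sum fun i _ => ContDiff.sub ?_ ?_)
  · exact contDiff_ell.comp (contDiff_const.inner ℝ contDiff_id)
  · exact contDiff_const.mul (contDiff_const.inner ℝ contDiff_id)

lemma HasDerivAt.comp_line {f : ℝ → ℝ} {f' : ℝ} (a b t : ℝ) (hf : HasDerivAt f f' (a + t * b)) :
    HasDerivAt (fun s => f (a + s * b)) (f' * b) t := by
  have h : HasDerivAt (fun s : ℝ => a + s * b) b t := by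
    simpa using ((hasDerivAt_id t).mul_const b).const_add a
  exact hf.comp t h

section Line

variable {n p : ℕ} (x : Fin n → EuclideanSpace ℝ (Fin p)) (y : Fin n → ℝ)
  (w v : EuclideanSpace ℝ (Fin p))

lemma deriv_empRisk_line :
    (deriv fun s : ℝ => empRisk x y (w + s • v)) = fun t => (1 / n : ℝ) *
      ∑ i, (ellDeriv (dotE w (x i) + t * dotE v (x i)) * dotE v (x i)
        - y i / 2 * dotE v (x i)) := by
  funext t
  simp only [empRisk, dotE_add_smul]
  refine ((HasDerivAt.fun_sum fun i _ => ?_).const_mul _).deriv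
  refine ((hasDerivAt_ell _).comp_line _ _ t).sub ?_
  simpa using ((hasDerivAt_id _).comp_line (dotE w (x i)) (dotE v (x i)) t).const_mul (y i / 2)

lemma deriv_deriv_empRisk_line :
    (deriv (deriv fun s : ℝ => empRisk x y (w + s • v))) = fun t => (1 / n : ℝ) *
      ∑ i, ellDeriv2 (dotE w (x i) + t * dotE v (x i)) * dotE v (x i) * dotE v (x i) := by
  funext t
  rw [deriv_empRisk_line]
  refine ((HasDerivAt.fun_sum fun i _ => ?_).const_mul _).deriv
  exact (((hasDerivAt_ellDeriv _).comp_line _ _ t).mul_const _).sub_const _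

lemma deriv_deriv_deriv_empRisk_line :
    (deriv (deriv (deriv fun s : ℝ => empRisk x y (w + s • v)))) = fun t => (1 / n : ℝ) *
      ∑ i, ellDeriv3 (dotE w (x i) + t * dotE v (x i)) * dotE v (x i) * dotE v (x i)
        * dotE v (x i) := by
  funext t
  rw [deriv_deriv_empRisk_line]
  refine ((HasDerivAt.fun_sum fun i _ => ?_).const_mul _).deriv
  exact (((hasDerivAt_ellDeriv2 _).comp_line _ _ t).mul_const _).mul_const _

end Line

/-- Let `x₁, …, xₙ ∈ ℝ^p` with `R = max_i ‖xᵢ‖₂`, let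
`y₁, …, yₙ ∈ {−1, 1}`, and define `Ĵ₀(w) = (1/n)·Σᵢ [ℓ(wᵀxᵢ) − (yᵢ/2)·wᵀxᵢ]` where
`ℓ(u) = log(e^{−u/2} + e^{u/2})`. Then `Ĵ₀` is convex, three times differentiable,
and for all `w, v ∈ ℝ^p` the function `g(t) = Ĵ₀(w + t·v)` satisfies
`|g'''(t)| ≤ R·‖v‖₂·g''(t)` for all `t ∈ ℝ`. -/
theorem empirical_logistic_risk_pseudo_self_concordant
    (n p : ℕ) (hn : 0 < n) (x : Fin n → EuclideanSpace ℝ (Fin p))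
    (R : ℝ) (hR : IsGreatest (Set.range fun i => ‖x i‖) R)
    (y : Fin n → ℝ) (hy : ∀ i, y i = 1 ∨ y i = -1) :
    ConvexOn ℝ Set.univ (empRisk x y) ∧
    ContDiff ℝ 3 (empRisk x y) ∧
    ∀ w v : EuclideanSpace ℝ (Fin p), ∀ t : ℝ,
      |deriv (deriv (deriv fun s : ℝ => empRisk x y (w + s • v))) t| ≤
        R * ‖v‖ * deriv (deriv fun s : ℝ => empRisk x y (w + s • v)) t := by
  refine ⟨convexOn_empRisk x y, contDiff_empRisk x y, fun w v t => ?_⟩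
  rw [deriv_deriv_deriv_empRisk_line, deriv_deriv_empRisk_line]
  simp only
  rw [abs_mul, abs_of_nonneg (by positivity : (0 : ℝ) ≤ 1 / n), mul_left_comm (R * ‖v‖)]
  refine mul_le_mul_of_nonneg_left ?_ (by positivity)
  rw [Finset.mul_sum]
  refine (Finset.abs_sum_le_sum_abs _ _).trans (Finset.sum_le_sum fun i _ => ?_)
  have hd : |dotE v (x i)| ≤ R * ‖v‖ :=
    (abs_dotE_le v (x i)).trans
      (mul_le_mul_of_nonneg_right (hR.2 ⟨i, rfl⟩) (norm_nonneg v))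
  have h3 := abs_ellDeriv3_le (dotE w (x i) + t * dotE v (x i))
  have h2 := ellDeriv2_nonneg (dotE w (x i) + t * dotE v (x i))
  have hsq := mul_self_nonneg (dotE v (x i))
  calc |ellDeriv3 (dotE w (x i) + t * dotE v (x i)) * dotE v (x i) * dotE v (x i) * dotE v (x i)|
      = |ellDeriv3 (dotE w (x i) + t * dotE v (x i))| * (dotE v (x i) * dotE v (x i)) *
          |dotE v (x i)| := by
        rw [mul_assoc (ellDeriv3 _), abs_mul, abs_mul, abs_mul_self]
    _ ≤ ellDeriv2 (dotE w (x i) + t * dotE v (x i)) * (dotE v (x i) * dotE v (x i)) *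
          (R * ‖v‖) :=
        mul_le_mul (mul_le_mul_of_nonneg_right h3 hsq) hd (abs_nonneg _) (mul_nonneg h2 hsq)
    _ = R * ‖v‖ *
          (ellDeriv2 (dotE w (x i) + t * dotE v (x i)) * dotE v (x i) * dotE v (x i)) := by
        ring
end
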